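/- arXiv:math/0112215 — 7 statements merged into one kernel-verified Lean document; each statement's English description precedes it below -/
import Mathlib

section
/- In the formal Kähler–de Rham setting, the anticommutation relations {(d′)*, d} = 0 and {d*, d′} = 0 hold, i.e. (d′)*∘d + d∘(d′)* = 0 and d*∘d′ + d′∘d* = 0. -/
theorem kdr_anticommute_mixed
    {V : Type*} [AddCommGroup V] [Module ℂ V]
    (L Lam H d d' : Module.End ℂ V)
    -- sl(2)-triple relations
    (hLLam : L * Lam - Lam * L = H)
    (hHL : H * L - L * H = 2 • L)
    (hHLam : H * Lam - Lam * H = -(2 • Lam))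
    -- weight-1 conditions on d and d′
    (hHd : H * d - d * H = d)
    (hHd' : H * d' - d' * H = d')
    (hLd : L * d - d * L = 0)
    (hLd' : L * d' - d' * L = 0)
    (hLamLamd : Lam * (Lam * d - d * Lam) - (Lam * d - d * Lam) * Lam = 0)
    (hLamLamd' : Lam * (Lam * d' - d' * Lam) - (Lam * d' - d' * Lam) * Lam = 0)
    -- differentials square to zero and anticommute
    (hdd : d * d = 0)
    (hd'd' : d' * d' = 0)
    (hdd' : d * d' + d' * d = 0)
    -- the operators d* = [Λ, d′] and (d′)* = -[Λ, d]
    (dstar dcstar : Module.End ℂ V)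
    (hdstar : dstar = Lam * d' - d' * Lam)
    (hdcstar : dcstar = d * Lam - Lam * d)
    :
    dcstar * d + d * dcstar = 0 ∧ dstar * d' + d' * dstar = 0 := by
  subst hdstar hdcstar
  constructor
  · have h : (d * Lam - Lam * d) * d + d * (d * Lam - Lam * d) =
        d * d * Lam - Lam * (d * d) := by noncomm_ring
    rw [h, hdd, zero_mul, mul_zero, sub_zero]
  · have h : (Lam * d' - d' * Lam) * d' + d' * (Lam * d' - d' * Lam) =
        Lam * (d' * d') - d' * d' * Lam := by noncomm_ring
    rw [h, hd'd', zero_mul, mul_zero, sub_zero]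
end

section
/- In the formal Kähler–de Rham setting, the operators d* and (d′)* square to zero: d*∘d* = 0 and (d′)*∘(d′)* = 0. -/
/-- If `d` squares to zero and `x` commutes with `[x, d]`, then `[x, d]` squares to zero: apply the
derivation `[x, ·]` twice to `d * d = 0`. -/
theorem commutator_mul_self_eq_zero (K : Type*) {R : Type*} [Field K] [CharZero K]
    [Ring R] [Algebra K R] {x d : R}
    (hx : x * (x * d - d * x) - (x * d - d * x) * x = 0) (hd : d * d = 0) :
    (x * d - d * x) * (x * d - d * x) = 0 := by
  have key : 2 • ((x * d - d * x) * (x * d - d * x)) =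
      x * x * (d * d) - 2 • (x * (d * d) * x) + d * d * x * x
        - (x * (x * d - d * x) - (x * d - d * x) * x) * d
        - d * (x * (x * d - d * x) - (x * d - d * x) * x) := by
    noncomm_ring
  rw [hx, hd] at key
  have key' : (2 : K) • ((x * d - d * x) * (x * d - d * x)) = 0 := by
    rw [ofNat_smul_eq_nsmul K 2, key]
    simp
  exact (smul_eq_zero.mp key').resolve_left two_ne_zero

theorem kdr_adjoints_square_zero
    {V : Type*} [AddCommGroup V] [Module ℂ V]
    (L Lam H d d' : Module.End ℂ V)
    -- sl(2)-triple relations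
    (hLLam : L * Lam - Lam * L = H)
    (hHL : H * L - L * H = 2 • L)
    (hHLam : H * Lam - Lam * H = -(2 • Lam))
    -- weight-1 conditions on d and d′
    (hHd : H * d - d * H = d)
    (hHd' : H * d' - d' * H = d')
    (hLd : L * d - d * L = 0)
    (hLd' : L * d' - d' * L = 0)
    (hLamLamd : Lam * (Lam * d - d * Lam) - (Lam * d - d * Lam) * Lam = 0)
    (hLamLamd' : Lam * (Lam * d' - d' * Lam) - (Lam * d' - d' * Lam) * Lam = 0)
    -- differentials square to zero and anticommute
    (hdd : d * d = 0)
    (hd'd' : d' * d' = 0)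
    (hdd' : d * d' + d' * d = 0)
    -- the operators d* = [Λ, d′] and (d′)* = -[Λ, d]
    (dstar dcstar : Module.End ℂ V)
    (hdstar : dstar = Lam * d' - d' * Lam)
    (hdcstar : dcstar = d * Lam - Lam * d)
    :
    dstar * dstar = 0 ∧ dcstar * dcstar = 0 := by
  have h := commutator_mul_self_eq_zero ℂ hLamLamd hdd
  refine ⟨hdstar ▸ commutator_mul_self_eq_zero ℂ hLamLamd' hd'd', ?_⟩
  rw [hdcstar, ← neg_sub (Lam * d) (d * Lam), neg_mul_neg, h]
end

section
/- In the formal Kähler–de Rham setting, the operators d* and (d′)* anticommute: {(d′)*, d*} = (d′)*∘d* + d*∘(d′)* = 0. -/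
/-- Leibniz rule for the second iterate of the derivation `[x, ·]` on an anticommutator. -/
theorem two_nsmul_anticommutator_commutator {R : Type*} [Ring R] (x a b : R) :
    2 • ((x * a - a * x) * (x * b - b * x) + (x * b - b * x) * (x * a - a * x)) =
      (x * (x * (a * b + b * a) - (a * b + b * a) * x)
        - (x * (a * b + b * a) - (a * b + b * a) * x) * x)
      - ((x * (x * a - a * x) - (x * a - a * x) * x) * b
        + b * (x * (x * a - a * x) - (x * a - a * x) * x))
      - (a * (x * (x * b - b * x) - (x * b - b * x) * x)
        + (x * (x * b - b * x) - (x * b - b * x) * x) * a) := by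
  noncomm_ring


theorem kdr_adjoints_anticommute
    {V : Type*} [AddCommGroup V] [Module ℂ V]
    (L Lam H d d' : Module.End ℂ V)
    -- sl(2)-triple relations
    (hLLam : L * Lam - Lam * L = H)
    (hHL : H * L - L * H = 2 • L)
    (hHLam : H * Lam - Lam * H = -(2 • Lam))
    -- weight-1 conditions on d and d′
    (hHd : H * d - d * H = d)
    (hHd' : H * d' - d' * H = d')
    (hLd : L * d - d * L = 0)
    (hLd' : L * d' - d' * L = 0)
    (hLamLamd : Lam * (Lam * d - d * Lam) - (Lam * d - d * Lam) * Lam = 0)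
    (hLamLamd' : Lam * (Lam * d' - d' * Lam) - (Lam * d' - d' * Lam) * Lam = 0)
    -- differentials square to zero and anticommute
    (hdd : d * d = 0)
    (hd'd' : d' * d' = 0)
    (hdd' : d * d' + d' * d = 0)
    -- the operators d* = [Λ, d′] and (d′)* = -[Λ, d]
    (dstar dcstar : Module.End ℂ V)
    (hdstar : dstar = Lam * d' - d' * Lam)
    (hdcstar : dcstar = d * Lam - Lam * d)
    :
    dcstar * dstar + dstar * dcstar = 0 := by
  subst hdstar hdcstar
  have key := two_nsmul_anticommutator_commutator Lam d d'
  rw [hLamLamd, hLamLamd', hdd'] at key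
  have two : (2 : ℂ) • ((Lam * d - d * Lam) * (Lam * d' - d' * Lam)
      + (Lam * d' - d' * Lam) * (Lam * d - d * Lam)) = 0 := by
    rw [ofNat_smul_eq_nsmul, key]
    simp
  have h := (smul_eq_zero.mp two).resolve_left two_ne_zero
  rw [← neg_sub (Lam * d) (d * Lam), neg_mul, mul_neg, ← neg_add, h, neg_zero]
end

section
/- In the formal Kähler–de Rham setting, the two Laplacians coincide: {d, d*} = {d′, (d′)*}, i.e. d∘d* + d*∘d = d′∘(d′)* + (d′)*∘d′. (This common operator is denoted Δ.) -/
theorem kdr_laplacians_coincide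
    {V : Type*} [AddCommGroup V] [Module ℂ V]
    (L Lam H d d' : Module.End ℂ V)
    -- sl(2)-triple relations
    (hLLam : L * Lam - Lam * L = H)
    (hHL : H * L - L * H = 2 • L)
    (hHLam : H * Lam - Lam * H = -(2 • Lam))
    -- weight-1 conditions on d and d′
    (hHd : H * d - d * H = d)
    (hHd' : H * d' - d' * H = d')
    (hLd : L * d - d * L = 0)
    (hLd' : L * d' - d' * L = 0)
    (hLamLamd : Lam * (Lam * d - d * Lam) - (Lam * d - d * Lam) * Lam = 0)
    (hLamLamd' : Lam * (Lam * d' - d' * Lam) - (Lam * d' - d' * Lam) * Lam = 0)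
    -- differentials square to zero and anticommute
    (hdd : d * d = 0)
    (hd'd' : d' * d' = 0)
    (hdd' : d * d' + d' * d = 0)
    -- the operators d* = [Λ, d′] and (d′)* = -[Λ, d]
    (dstar dcstar : Module.End ℂ V)
    (hdstar : dstar = Lam * d' - d' * Lam)
    (hdcstar : dcstar = d * Lam - Lam * d)
    :
    d * dstar + dstar * d = d' * dcstar + dcstar * d' := by
  have key : Lam * (d * d' + d' * d) - (d * d' + d' * d) * Lam = 0 := by
    rw [hdd', mul_zero, zero_mul, sub_zero]
  rw [hdstar, hdcstar, ← sub_eq_zero, ← key]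
  noncomm_ring
end

section
/- In the formal Kähler–de Rham setting, the Laplacian Δ := d∘d* + d*∘d commutes with each of the four operators d, d′, d*, (d′)*: [Δ, d] = [Δ, d′] = [Δ, d*] = [Δ, (d′)*] = 0. -/
/-- If `x` squares to zero, it commutes with its anticommutator with any `y`. -/
theorem anticommutator_commutes_of_sq_eq_zero {R : Type*} [Ring R] {x : R} (y : R)
    (hx : x * x = 0) : (x * y + y * x) * x - x * (x * y + y * x) = 0 := by
  have h : (x * y + y * x) * x - x * (x * y + y * x) = y * (x * x) - (x * x) * y := by
    noncomm_ring
  rw [h, hx, mul_zero, zero_mul, sub_zero]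

/-- If `x` squares to zero and `[l, [l, x]] = 0`, then `[l, x]` squares to zero. -/
theorem commutator_sq_eq_zero {R : Type*} [Ring R] [Module ℂ R] {l x : R} (hx : x * x = 0)
    (hl : l * (l * x - x * l) - (l * x - x * l) * l = 0) :
    (l * x - x * l) * (l * x - x * l) = 0 := by
  have h : (2 : ℂ) • ((l * x - x * l) * (l * x - x * l)) =
      l * (l * (x * x) - (x * x) * l) - (l * (x * x) - (x * x) * l) * l
        - (l * (l * x - x * l) - (l * x - x * l) * l) * x
        - x * (l * (l * x - x * l) - (l * x - x * l) * l) := by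
    rw [two_smul]
    noncomm_ring
  rw [hl, hx] at h
  have h2 : (2 : ℂ) • ((l * x - x * l) * (l * x - x * l)) = 0 := by simpa using h
  exact (smul_eq_zero.mp h2).resolve_left two_ne_zero


theorem kdr_laplacian_commutes_with_differentials
    {V : Type*} [AddCommGroup V] [Module ℂ V]
    (L Lam H d d' : Module.End ℂ V)
    -- sl(2)-triple relations
    (hLLam : L * Lam - Lam * L = H)
    (hHL : H * L - L * H = 2 • L)
    (hHLam : H * Lam - Lam * H = -(2 • Lam))
    -- weight-1 conditions on d and d′
    (hHd : H * d - d * H = d)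
    (hHd' : H * d' - d' * H = d')
    (hLd : L * d - d * L = 0)
    (hLd' : L * d' - d' * L = 0)
    (hLamLamd : Lam * (Lam * d - d * Lam) - (Lam * d - d * Lam) * Lam = 0)
    (hLamLamd' : Lam * (Lam * d' - d' * Lam) - (Lam * d' - d' * Lam) * Lam = 0)
    -- differentials square to zero and anticommute
    (hdd : d * d = 0)
    (hd'd' : d' * d' = 0)
    (hdd' : d * d' + d' * d = 0)
    -- the operators d* = [Λ, d′] and (d′)* = -[Λ, d]
    (dstar dcstar : Module.End ℂ V)
    (hdstar : dstar = Lam * d' - d' * Lam)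
    (hdcstar : dcstar = d * Lam - Lam * d)
    (Δ : Module.End ℂ V)
    (hΔ : Δ = d * dstar + dstar * d)
    :
    Δ * d - d * Δ = 0 ∧ Δ * d' - d' * Δ = 0 ∧
    Δ * dstar - dstar * Δ = 0 ∧ Δ * dcstar - dcstar * Δ = 0 := by
  have ha := commutator_sq_eq_zero hdd hLamLamd
  have hb := commutator_sq_eq_zero hd'd' hLamLamd'
  have hc : dcstar * dcstar = 0 := by
    rw [hdcstar, ← neg_sub, neg_mul_neg, ha]
  rw [← hdstar] at hb
  have hΔ' : Δ = d' * dcstar + dcstar * d' := by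
    have h : Δ - (d' * dcstar + dcstar * d') =
        Lam * (d * d' + d' * d) - (d * d' + d' * d) * Lam := by
      rw [hΔ, hdstar, hdcstar]
      noncomm_ring
    rwa [hdd', mul_zero, zero_mul, sub_zero, sub_eq_zero] at h
  refine ⟨?_, ?_, ?_, ?_⟩
  · rw [hΔ]
    exact anticommutator_commutes_of_sq_eq_zero dstar hdd
  · rw [hΔ']
    exact anticommutator_commutes_of_sq_eq_zero dcstar hd'd'
  · rw [hΔ, add_comm]
    exact anticommutator_commutes_of_sq_eq_zero d hb
  · rw [hΔ', add_comm]
    exact anticommutator_commutes_of_sq_eq_zero d' hc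
end

section
/- In the formal Kähler–de Rham setting, the Laplacian Δ := d∘d* + d*∘d commutes with the sl(2)-triple: [Δ, L] = [Δ, Λ] = [Δ, H] = 0. -/
section AnticommutatorLeibniz

variable {R : Type*} [Ring R]

/-- The Leibniz rule for a commutator acting on a commutator. -/
theorem commutator_commutator_leibniz (x a b : R) :
    x * (a * b - b * a) - (a * b - b * a) * x =
      ((x * a - a * x) * b - b * (x * a - a * x)) +
        (a * (x * b - b * x) - (x * b - b * x) * a) := by
  noncomm_ring

/-- The Leibniz rule for a commutator acting on an anticommutator. -/
theorem commutator_anticommutator_leibniz (x a b : R) :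
    x * (a * b + b * a) - (a * b + b * a) * x =
      ((x * a - a * x) * b + b * (x * a - a * x)) +
        (a * (x * b - b * x) + (x * b - b * x) * a) := by
  noncomm_ring

end AnticommutatorLeibniz


theorem kdr_laplacian_commutes_with_sl2
    {V : Type*} [AddCommGroup V] [Module ℂ V]
    (L Lam H d d' : Module.End ℂ V)
    -- sl(2)-triple relations
    (hLLam : L * Lam - Lam * L = H)
    (hHL : H * L - L * H = 2 • L)
    (hHLam : H * Lam - Lam * H = -(2 • Lam))
    -- weight-1 conditions on d and d′
    (hHd : H * d - d * H = d)
    (hHd' : H * d' - d' * H = d')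
    (hLd : L * d - d * L = 0)
    (hLd' : L * d' - d' * L = 0)
    (hLamLamd : Lam * (Lam * d - d * Lam) - (Lam * d - d * Lam) * Lam = 0)
    (hLamLamd' : Lam * (Lam * d' - d' * Lam) - (Lam * d' - d' * Lam) * Lam = 0)
    -- differentials square to zero and anticommute
    (hdd : d * d = 0)
    (hd'd' : d' * d' = 0)
    (hdd' : d * d' + d' * d = 0)
    -- the operators d* = [Λ, d′] and (d′)* = -[Λ, d]
    (dstar dcstar : Module.End ℂ V)
    (hdstar : dstar = Lam * d' - d' * Lam)
    (hdcstar : dcstar = d * Lam - Lam * d)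
    (Δ : Module.End ℂ V)
    (hΔ : Δ = d * dstar + dstar * d)
    :
    Δ * L - L * Δ = 0 ∧ Δ * Lam - Lam * Δ = 0 ∧ Δ * H - H * Δ = 0 := by
  have hL : L * dstar - dstar * L = d' := by
    rw [hdstar, commutator_commutator_leibniz, hLLam, hLd', hHd']
    simp
  have hH : H * dstar - dstar * H = -dstar := by
    rw [hdstar, commutator_commutator_leibniz, hHLam, hHd']
    noncomm_ring
  have hLam : Lam * dstar - dstar * Lam = 0 := by rw [hdstar, hLamLamd']
  have hstar : (Lam * d - d * Lam) * dstar + dstar * (Lam * d - d * Lam) = 0 := by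
    have h₁ : ((Lam * d - d * Lam) * d' + d' * (Lam * d - d * Lam)) +
        (d * dstar + dstar * d) = 0 := by
      rw [hdstar, ← commutator_anticommutator_leibniz, hdd']
      simp
    have h₂ : (2 : ℂ) • ((Lam * d - d * Lam) * dstar + dstar * (Lam * d - d * Lam)) = 0 := by
      have h₃ := congrArg (fun x => Lam * x - x * Lam) h₁
      simp only [mul_add Lam, add_mul _ _ Lam, mul_zero, zero_mul, sub_zero] at h₃
      have e₁ := commutator_anticommutator_leibniz Lam (Lam * d - d * Lam) d'
      have e₂ := commutator_anticommutator_leibniz Lam d dstar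
      rw [hLamLamd, ← hdstar] at e₁
      rw [hLam] at e₂
      simp only [mul_add Lam, add_mul _ _ Lam, mul_zero, zero_mul, add_zero, zero_add] at e₁ e₂
      rw [add_sub_add_comm, e₁, e₂] at h₃
      rw [two_smul]
      exact h₃
    exact (smul_eq_zero.mp h₂).resolve_left two_ne_zero
  refine ⟨?_, ?_, ?_⟩ <;> rw [← neg_sub, neg_eq_zero, hΔ, commutator_anticommutator_leibniz]
  · rw [hLd, hL, hdd']
    simp
  · rw [hstar, hLam]
    simp
  · rw [hHd, hH]
    noncomm_ring
end

section
/- In the formal Kähler–de Rham setting, let 𝔰 ⊆ End(V) be the ℂ-linear span of the eight operators L, Λ, H, Δ, d, d′, d*, (d′)*, where Δ := d∘d* + d*∘d. Then 𝔰 is closed under the supercommutator: the commutator [x, y] = xy − yx lies in 𝔰 whenever x ∈ {L, Λ, H, Δ} and y is any of the eight operators, and the anticommutator {x, y} = xy + yx lies in 𝔰 whenever x, y ∈ {d, d′, d*, (d′)*}. Consequently, the Lie superalgebra of endomorphisms generated by the even elements L, Λ, H and the odd elements d, d′ is spanned by these eight operators. -/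
theorem kdr_eight_dimensional_span_closed
    {V : Type*} [AddCommGroup V] [Module ℂ V]
    (L Lam H d d' : Module.End ℂ V)
    -- sl(2)-triple relations
    (hLLam : L * Lam - Lam * L = H)
    (hHL : H * L - L * H = 2 • L)
    (hHLam : H * Lam - Lam * H = -(2 • Lam))
    -- weight-1 conditions on d and d′
    (hHd : H * d - d * H = d)
    (hHd' : H * d' - d' * H = d')
    (hLd : L * d - d * L = 0)
    (hLd' : L * d' - d' * L = 0)
    (hLamLamd : Lam * (Lam * d - d * Lam) - (Lam * d - d * Lam) * Lam = 0)
    (hLamLamd' : Lam * (Lam * d' - d' * Lam) - (Lam * d' - d' * Lam) * Lam = 0)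
    -- differentials square to zero and anticommute
    (hdd : d * d = 0)
    (hd'd' : d' * d' = 0)
    (hdd' : d * d' + d' * d = 0)
    -- the operators d* = [Λ, d′] and (d′)* = -[Λ, d]
    (dstar dcstar : Module.End ℂ V)
    (hdstar : dstar = Lam * d' - d' * Lam)
    (hdcstar : dcstar = d * Lam - Lam * d)
    (Δ : Module.End ℂ V)
    (hΔ : Δ = d * dstar + dstar * d)
    (S : Submodule ℂ (Module.End ℂ V))
    (hS : S = Submodule.span ℂ
      ({L, Lam, H, Δ, d, d', dstar, dcstar} : Set (Module.End ℂ V)))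
    :
    (∀ x ∈ ({L, Lam, H, Δ} : Set (Module.End ℂ V)),
      ∀ y ∈ ({L, Lam, H, Δ, d, d', dstar, dcstar} : Set (Module.End ℂ V)),
        x * y - y * x ∈ S) ∧
    (∀ x ∈ ({d, d', dstar, dcstar} : Set (Module.End ℂ V)),
      ∀ y ∈ ({d, d', dstar, dcstar} : Set (Module.End ℂ V)),
        x * y + y * x ∈ S) := by
  have hLamdstar : Lam * dstar - dstar * Lam = 0 := by rw [hdstar]; exact hLamLamd'
  have hLamdcstar : Lam * dcstar - dcstar * Lam = 0 := by
    rw [hdcstar]; linear_combination (norm := noncomm_ring) -hLamLamd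
  have hLdstar : L * dstar - dstar * L = d' := by
    linear_combination (norm := noncomm_ring) L * hdstar - hdstar * L + hLLam * d' - d' * hLLam
      + hHd' + Lam * hLd' - hLd' * Lam
  have hLdcstar : L * dcstar - dcstar * L = -d := by
    linear_combination (norm := noncomm_ring) L * hdcstar - hdcstar * L - hLLam * d + d * hLLam
      - hHd - Lam * hLd + hLd * Lam
  have hHdstar : H * dstar - dstar * H = -dstar := by
    linear_combination (norm := noncomm_ring) H * hdstar - hdstar * H + hdstar + hHLam * d'
      - d' * hHLam + Lam * hHd' - hHd' * Lam
  have hHdcstar : H * dcstar - dcstar * H = -dcstar := by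
    linear_combination (norm := noncomm_ring) H * hdcstar - hdcstar * H + hdcstar - hHLam * d
      + d * hHLam - Lam * hHd + hHd * Lam
  have hddcstar : d * dcstar + dcstar * d = 0 := by
    linear_combination (norm := noncomm_ring) d * hdcstar + hdcstar * d + hdd * Lam - Lam * hdd
  have hd'dstar : d' * dstar + dstar * d' = 0 := by
    linear_combination (norm := noncomm_ring) d' * hdstar + hdstar * d' - hd'd' * Lam
      + Lam * hd'd'
  have hd'dcstar : d' * dcstar + dcstar * d' = Δ := by
    linear_combination (norm := noncomm_ring) d' * hdcstar + hdcstar * d' - hΔ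
      - d * hdstar - hdstar * d - Lam * hdd' + hdd' * Lam
  have hdstarsq : dstar * dstar + dstar * dstar = 0 := by
    linear_combination (norm := noncomm_ring) Lam * hd'dstar - hd'dstar * Lam
      + hdstar * dstar + dstar * hdstar - d' * hLamdstar - hLamdstar * d'
  have hdcstarsq : dcstar * dcstar + dcstar * dcstar = 0 := by
    linear_combination (norm := noncomm_ring) -(Lam * hddcstar) + hddcstar * Lam
      + hdcstar * dcstar + dcstar * hdcstar + d * hLamdcstar + hLamdcstar * d
  have eq_zero_of_add_self {a : Module.End ℂ V} (h : a + a = 0) : a = 0 := by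
    rw [← two_smul ℂ] at h
    exact (smul_eq_zero.mp h).resolve_left two_ne_zero
  have hdstarsq' := eq_zero_of_add_self hdstarsq
  have hdcstarsq' := eq_zero_of_add_self hdcstarsq
  have hLamΔ : Lam * Δ - Δ * Lam = dstar * dcstar + dcstar * dstar := by
    linear_combination (norm := noncomm_ring) -(Lam * hd'dcstar) + hd'dcstar * Lam
      - hdstar * dcstar - dcstar * hdstar + d' * hLamdcstar + hLamdcstar * d'
  have hLamΔ' : Lam * Δ - Δ * Lam = -(dstar * dcstar + dcstar * dstar) := by
    linear_combination (norm := noncomm_ring) Lam * hΔ - hΔ * Lam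
      + hdcstar * dstar + dstar * hdcstar + d * hLamdstar + hLamdstar * d
  have hdstardcstar : dstar * dcstar + dcstar * dstar = 0 := by
    apply eq_zero_of_add_self
    linear_combination (norm := noncomm_ring) hLamΔ' - hLamΔ
  rw [hdstardcstar] at hLamΔ
  have hLΔ : L * Δ - Δ * L = 0 := by
    linear_combination (norm := noncomm_ring) L * hΔ - hΔ * L + hLd * dstar + dstar * hLd
      + d * hLdstar + hLdstar * d + hdd'
  have hHΔ : H * Δ - Δ * H = 0 := by
    linear_combination (norm := noncomm_ring) H * hΔ - hΔ * H + hHd * dstar + dstar * hHd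
      + d * hHdstar + hHdstar * d
  have hΔd : Δ * d - d * Δ = 0 := by
    linear_combination (norm := noncomm_ring) hΔ * d - d * hΔ + dstar * hdd - hdd * dstar
  have hΔdstar : Δ * dstar - dstar * Δ = 0 := by
    linear_combination (norm := noncomm_ring) hΔ * dstar - dstar * hΔ + d * hdstarsq'
      - hdstarsq' * d
  have hΔd' : Δ * d' - d' * Δ = 0 := by
    linear_combination (norm := noncomm_ring) -(hd'dcstar * d') + d' * hd'dcstar
      + dcstar * hd'd' - hd'd' * dcstar
  have hΔdcstar : Δ * dcstar - dcstar * Δ = 0 := by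
    linear_combination (norm := noncomm_ring) -(hd'dcstar * dcstar) + dcstar * hd'dcstar
      + d' * hdcstarsq' - hdcstarsq' * d'
  have mem {x : Module.End ℂ V}
      (hx : x ∈ ({L, Lam, H, Δ, d, d', dstar, dcstar} : Set (Module.End ℂ V))) : x ∈ S :=
    hS ▸ Submodule.subset_span hx
  have mL : L ∈ S := mem (by simp)
  have mLam : Lam ∈ S := mem (by simp)
  have mH : H ∈ S := mem (by simp)
  have mΔ : Δ ∈ S := mem (by simp)
  have md : d ∈ S := mem (by simp)
  have md' : d' ∈ S := mem (by simp)
  have mdstar : dstar ∈ S := mem (by simp)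
  have mdcstar : dcstar ∈ S := mem (by simp)
  have swap {x y : Module.End ℂ V} (h : x * y - y * x ∈ S) : y * x - x * y ∈ S := by
    rw [← neg_sub]; exact S.neg_mem h
  have swap' {x y : Module.End ℂ V} (h : x * y + y * x ∈ S) : y * x + x * y ∈ S := by
    rwa [add_comm]
  have of_zero {x : Module.End ℂ V} (h : x = 0) : x ∈ S := h ▸ S.zero_mem
  have cLLam : L * Lam - Lam * L ∈ S := by rwa [hLLam]
  have cHL : H * L - L * H ∈ S := by rw [hHL]; exact S.smul_of_tower_mem 2 mL
  have cHLam : H * Lam - Lam * H ∈ S := by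
    rw [hHLam]; exact S.neg_mem (S.smul_of_tower_mem 2 mLam)
  have cLamd : Lam * d - d * Lam ∈ S := by rw [← neg_sub, ← hdcstar]; exact S.neg_mem mdcstar
  have cLamd' : Lam * d' - d' * Lam ∈ S := by rwa [← hdstar]
  have zself (x : Module.End ℂ V) : x * x - x * x ∈ S := of_zero (sub_self _)
  simp only [Set.mem_insert_iff, Set.mem_singleton_iff, forall_eq_or_imp, forall_eq]
  refine ⟨⟨?_, ?_, ?_, ?_⟩, ?_, ?_, ?_, ?_⟩
  · exact ⟨zself L, cLLam, swap cHL, of_zero hLΔ, of_zero hLd, of_zero hLd', hLdstar ▸ md',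
      hLdcstar ▸ S.neg_mem md⟩
  · exact ⟨swap cLLam, zself Lam, swap cHLam, of_zero hLamΔ, cLamd, cLamd', of_zero hLamdstar,
      of_zero hLamdcstar⟩
  · exact ⟨cHL, cHLam, zself H, of_zero hHΔ, hHd.symm ▸ md, hHd'.symm ▸ md',
      hHdstar ▸ S.neg_mem mdstar, hHdcstar ▸ S.neg_mem mdcstar⟩
  · exact ⟨swap (of_zero hLΔ), swap (of_zero hLamΔ), swap (of_zero hHΔ), zself Δ, of_zero hΔd,
      of_zero hΔd', of_zero hΔdstar, of_zero hΔdcstar⟩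
  · exact ⟨of_zero (by simp [hdd]), of_zero hdd', hΔ ▸ mΔ, of_zero hddcstar⟩
  · exact ⟨swap' (of_zero hdd'), of_zero (by simp [hd'd']), of_zero hd'dstar, hd'dcstar.symm ▸ mΔ⟩
  · exact ⟨swap' (hΔ ▸ mΔ), swap' (of_zero hd'dstar), of_zero hdstarsq, of_zero hdstardcstar⟩
  · exact ⟨swap' (of_zero hddcstar), swap' (hd'dcstar.symm ▸ mΔ), swap' (of_zero hdstardcstar),
      of_zero hdcstarsq⟩
end
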